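/- (Lemma 2.7, estimate (2.22): Sobolev bounds on higher Picard iterates.) Let d ≥ 1 be an integer, let s ∈ ℝ satisfy s ≤ −1/2 if d = 1 and s < 0 if d ≥ 2, let μ ∈ {1,−1}, and let u₀ : ℝ^d → ℂ be a Schwartz function. There exists a constant C > 0, depending only on d and s, such that for all parameters R, A, N > 0 with 2 ≤ A, √d · A ≤ N and R A^d ≥ max(1, ‖u₀‖_{FL¹}), all integers j ≥ 1 and all t ≥ 0: ‖Θ_j(u₀ + φ_{R,A,N})(t)‖_{H^s} ≤ C^j t^j (R A^d)^{4j} ( R f_s(A) + ‖u₀‖_{L²} ). -/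

import Mathlib

open MeasureTheory

noncomputable section

abbrev Ed (d : ℕ) := EuclideanSpace ℝ (Fin d)

def fconv {d : ℕ} (f g : Ed d → ℂ) : Ed d → ℂ := fun ξ => ∫ η, f η * g (ξ - η)

def ftild {d : ℕ} (f : Ed d → ℂ) : Ed d → ℂ := fun η => (starRingEnd ℂ) (f (-η))

inductive Tree5 : Type where
  | leaf : Tree5
  | node : Tree5 → Tree5 → Tree5 → Tree5 → Tree5 → Tree5

def Tree5.internal : Tree5 → ℕ
  | .leaf => 0
  | .node a b c d e => a.internal + b.internal + c.internal + d.internal + e.internal + 1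

/-- The Fourier transform `F[Ψ_φ(T)(t)]` of the tree distribution, defined by recursion. -/
def FPsi (d : ℕ) (μ : ℝ) (g : Ed d → ℂ) : Tree5 → ℝ → Ed d → ℂ
  | .leaf => fun t ξ => Complex.exp (Complex.I * ((t : ℂ) * (‖ξ‖ : ℂ) ^ 4)) * g ξ
  | .node T1 T2 T3 T4 T5 => fun t ξ =>
      Complex.I * (μ : ℂ) * Complex.exp (Complex.I * ((t : ℂ) * (‖ξ‖ : ℂ) ^ 4)) *
        ∫ τ in (0:ℝ)..t,
          Complex.exp (-(Complex.I * ((τ : ℂ) * (‖ξ‖ : ℂ) ^ 4))) *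
            fconv (fconv (fconv (fconv (FPsi d μ g T1 τ) (ftild (FPsi d μ g T2 τ)))
              (FPsi d μ g T3 τ)) (ftild (FPsi d μ g T4 τ))) (FPsi d μ g T5 τ) ξ

/-- The Fourier transform of `Θ_j(φ)(t)`, the `j`-th term of the Picard series expansion. -/
def FTheta (d : ℕ) (μ : ℝ) (g : Ed d → ℂ) (j : ℕ) (t : ℝ) : Ed d → ℂ :=
  fun ξ => ∑' T : {T : Tree5 // T.internal = j}, FPsi d μ g T t ξ

open Set
open scoped ENNReal FourierTransform

/-- The cube `Q_A = [−A/2, A/2)^d ⊂ ℝ^d`. -/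
def QA (d : ℕ) (A : ℝ) : Set (Ed d) := {ξ | ∀ i, ξ i ∈ Ico (-(A / 2)) (A / 2)}

/-- The indicator function (ℂ-valued) of the translated cube `a + Q_A`. -/
def cubeIndC (d : ℕ) (A : ℝ) (a : Ed d) : Ed d → ℂ :=
  Set.indicator {ξ | ξ - a ∈ QA d A} (fun _ => 1)

/-- The first standard basis vector `e₁` of `ℝ^d`. -/
def e1 (d : ℕ) (hd : 0 < d) : Ed d := EuclideanSpace.single (⟨0, hd⟩ : Fin d) (1 : ℝ)

/-- The Fourier transform `φ̂_{R,A,N} = R (1_{N e₁+Q_A} + 1_{2N e₁+Q_A})` of the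
perturbation `φ_{R,A,N}`. -/
def phiHat (d : ℕ) (hd : 0 < d) (R A N : ℝ) : Ed d → ℂ := fun ξ =>
  (R : ℂ) * (cubeIndC d A (N • e1 d hd) ξ + cubeIndC d A ((2 * N) • e1 d hd) ξ)

/-- `f_s(A)`: `1` if `s < −d/2`; `(log A)^{1/2}` if `s = −d/2`; `A^{d/2+s}` if
`s > −d/2`. -/
def fS (d : ℕ) (s A : ℝ) : ℝ :=
  if s < -((d : ℝ) / 2) then 1
  else if s = -((d : ℝ) / 2) then (Real.log A) ^ ((1 : ℝ) / 2)
  else A ^ ((d : ℝ) / 2 + s)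

/-- The `H^s` norm computed from the Fourier transform `g = f̂`. -/
def hSobHat {d : ℕ} (s : ℝ) (g : Ed d → ℂ) : ℝ :=
  (∫ ξ : Ed d, (1 + ‖ξ‖ ^ 2) ^ s * ‖g ξ‖ ^ 2) ^ ((1 : ℝ) / 2)

theorem lconvolution_le_of_le {G : Type*} [AddGroup G] [MeasurableSpace G] {ν : Measure G}
    {f g : G → ℝ≥0∞} (hf : Measurable f) {c : ℝ≥0∞}
    (hg : ∀ x, g x ≤ c) (x : G) : (f ⋆ₗ[ν] g) x ≤ (∫⁻ y, f y ∂ν) * c := by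
  rw [lconvolution_def, ← lintegral_mul_const _ hf]
  exact lintegral_mono fun y => mul_le_mul_right (hg _) _

section Young

variable {G : Type*} [AddCommGroup G] [MeasurableSpace G] [MeasurableAdd₂ G] [MeasurableNeg G]
  {ν : Measure G}

theorem lintegral_lconvolution [SFinite ν] [ν.IsAddLeftInvariant] {f g : G → ℝ≥0∞} (hf : Measurable f) (hg : Measurable g) :
    ∫⁻ x, (f ⋆ₗ[ν] g) x ∂ν = (∫⁻ x, f x ∂ν) * ∫⁻ x, g x ∂ν := by
  simp only [lconvolution_def]
  rw [lintegral_lintegral_swap (by fun_prop)]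
  have h : ∀ y, ∫⁻ x, f y * g (-y + x) ∂ν = f y * ∫⁻ x, g x ∂ν := fun y => by
    rw [lintegral_const_mul _ (by fun_prop), lintegral_add_left_eq_self]
  simp only [h]
  exact lintegral_mul_const _ hf

theorem lconvolution_sq_le {f g : G → ℝ≥0∞} (hf : Measurable f) (hg : Measurable g) (x : G) :
    (f ⋆ₗ[ν] g) x ^ 2 ≤ (∫⁻ y, f y ∂ν) * (f ⋆ₗ[ν] fun y => g y ^ 2) x := by
  have key := ENNReal.lintegral_mul_le_Lp_mul_Lq (ν.withDensity f) Real.HolderConjugate.two_two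
    (f := fun _ => 1) (g := fun y => g (-y + x)) (by fun_prop) (by fun_prop)
  have h1 : ∫⁻ y, ((fun _ => 1 : G → ℝ≥0∞) * fun y => g (-y + x)) y ∂(ν.withDensity f)
      = (f ⋆ₗ[ν] g) x := by
    rw [lintegral_withDensity_eq_lintegral_mul _ hf (by fun_prop), lconvolution_def]
    simp
  have h2 : ∫⁻ y, g (-y + x) ^ (2 : ℝ) ∂(ν.withDensity f) = (f ⋆ₗ[ν] fun y => g y ^ 2) x := by
    rw [lintegral_withDensity_eq_lintegral_mul _ hf (by fun_prop), lconvolution_def]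
    simp
  rw [h1, h2] at key
  simp only [ENNReal.one_rpow, lintegral_one, withDensity_apply _ MeasurableSet.univ,
    Measure.restrict_univ] at key
  calc (f ⋆ₗ[ν] g) x ^ 2 ≤ _ := pow_le_pow_left₀ zero_le key 2
    _ = _ := by
      rw [mul_pow]
      congr 1 <;>
      · rw [← ENNReal.rpow_natCast, ← ENNReal.rpow_mul]
        norm_num

theorem lintegral_lconvolution_sq_le [SFinite ν] [ν.IsAddLeftInvariant] {f g : G → ℝ≥0∞} (hf : Measurable f) (hg : Measurable g) :
    ∫⁻ x, (f ⋆ₗ[ν] g) x ^ 2 ∂ν ≤ (∫⁻ x, f x ∂ν) ^ 2 * ∫⁻ x, g x ^ 2 ∂ν := by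
  calc _ ≤ ∫⁻ x, (∫⁻ y, f y ∂ν) * (f ⋆ₗ[ν] fun y => g y ^ 2) x ∂ν :=
        lintegral_mono (lconvolution_sq_le hf hg)
    _ = _ := by
      rw [lintegral_const_mul _ (by fun_prop), lintegral_lconvolution hf (by fun_prop)]
      ring

end Young

section Majorant

variable {d : ℕ}

theorem enorm_ftild (f : Ed d → ℂ) (η : Ed d) : ‖ftild f η‖ₑ = ‖f (-η)‖ₑ := by
  simp [ftild, ← ofReal_norm]

theorem enorm_fconv_le {f g : Ed d → ℂ} {F G : Ed d → ℝ≥0∞} {a b : ℝ≥0∞} (hF : Measurable F)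
    (hG : Measurable G) (hf : ∀ η, ‖f η‖ₑ ≤ a * F η) (hg : ∀ η, ‖g η‖ₑ ≤ b * G η) (ξ : Ed d) :
    ‖fconv f g ξ‖ₑ ≤ a * b * (F ⋆ₗ G) ξ := by
  rw [lconvolution_def, ← lintegral_const_mul _ (by fun_prop)]
  refine (enorm_integral_le_lintegral_enorm _).trans (lintegral_mono fun η => ?_)
  rw [enorm_mul, neg_add_eq_sub]
  calc _ ≤ a * F η * (b * G (ξ - η)) := mul_le_mul' (hf _) (hg _)
    _ = _ := by ring

/-- The pointwise majorant of the tree distribution of `T`: every leaf carries `h` and every node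
is the fivefold convolution of its children, the second and fourth ones being reflected. -/
def Tree5.majorant (h : Ed d → ℝ≥0∞) : Tree5 → Ed d → ℝ≥0∞
  | .leaf => h
  | .node T1 T2 T3 T4 T5 =>
      ((((T1.majorant h) ⋆ₗ fun η => T2.majorant h (-η)) ⋆ₗ T3.majorant h) ⋆ₗ
        fun η => T4.majorant h (-η)) ⋆ₗ T5.majorant h

theorem Tree5.measurable_majorant {h : Ed d → ℝ≥0∞} (hh : Measurable h) (T : Tree5) :
    Measurable (T.majorant h) := by
  induction T with
  | leaf => exact hh
  | node T1 T2 T3 T4 T5 h1 h2 h3 h4 h5 =>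
    unfold majorant
    fun_prop

theorem Tree5.lintegral_majorant {h : Ed d → ℝ≥0∞} (hh : Measurable h) (T : Tree5) :
    ∫⁻ ξ, T.majorant h ξ = (∫⁻ ξ, h ξ) ^ (4 * T.internal + 1) := by
  induction T with
  | leaf => simp [majorant, internal]
  | node T1 T2 T3 T4 T5 h1 h2 h3 h4 h5 =>
    have m := fun T : Tree5 => T.measurable_majorant hh
    have m1 := m T1
    have m2 := m T2
    have m3 := m T3
    have m4 := m T4
    have m5 := m T5
    unfold majorant
    rw [lintegral_lconvolution (by fun_prop) (by fun_prop),
      lintegral_lconvolution (by fun_prop) (by fun_prop),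
      lintegral_lconvolution (by fun_prop) (by fun_prop),
      lintegral_lconvolution (by fun_prop) (by fun_prop),
      lintegral_neg_eq_self (fun η => T2.majorant h η),
      lintegral_neg_eq_self (fun η => T4.majorant h η), h1, h2, h3, h4, h5,
      internal]
    ring

theorem norm_exp_I_mul_phase (t : ℝ) (ξ : Ed d) :
    ‖Complex.exp (Complex.I * ((t : ℂ) * (‖ξ‖ : ℂ) ^ 4))‖ₑ = 1 := by
  have h := Complex.norm_exp_I_mul_ofReal (t * ‖ξ‖ ^ 4)
  push_cast at h
  rw [← ofReal_norm, h, ENNReal.ofReal_one]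

theorem enorm_intervalIntegral_le_mul {f : ℝ → ℂ} {t : ℝ} (ht : 0 ≤ t) {c : ℝ≥0∞}
    (hf : ∀ τ ∈ Ioc 0 t, ‖f τ‖ₑ ≤ c) : ‖∫ τ in (0 : ℝ)..t, f τ‖ₑ ≤ ENNReal.ofReal t * c := by
  rw [intervalIntegral.integral_of_le ht]
  calc _ ≤ ∫⁻ τ in Ioc 0 t, ‖f τ‖ₑ := enorm_integral_le_lintegral_enorm _
    _ ≤ ∫⁻ _ in Ioc 0 t, c := setLIntegral_mono measurable_const hf
    _ = _ := by simp [mul_comm]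

theorem enorm_FPsi_le {μ : ℝ} (hμ : ‖μ‖ₑ = 1) {g : Ed d → ℂ} (hg : Measurable g) (T : Tree5) :
    ∀ t : ℝ, 0 ≤ t → ∀ ξ, ‖FPsi d μ g T t ξ‖ₑ ≤
      ENNReal.ofReal t ^ T.internal * T.majorant (fun η => ‖g η‖ₑ) ξ := by
  induction T with
  | leaf =>
    intro t _ ξ
    simp [FPsi, norm_exp_I_mul_phase, Tree5.internal, Tree5.majorant]
  | node T1 T2 T3 T4 T5 h1 h2 h3 h4 h5 =>
    intro t ht ξ
    have m := fun T : Tree5 => T.measurable_majorant hg.enorm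
    have m1 := m T1
    have m2 := m T2
    have m3 := m T3
    have m4 := m T4
    have m5 := m T5
    have hI : ‖Complex.I‖ₑ = 1 := by simp [← ofReal_norm]
    have hμ' : ‖(μ : ℂ)‖ₑ = 1 := by rw [← hμ, ← ofReal_norm, ← ofReal_norm, Complex.norm_real]
    have tild : ∀ (T : Tree5) (τ : ℝ), (∀ ξ, ‖FPsi d μ g T τ ξ‖ₑ ≤ ENNReal.ofReal τ ^ T.internal *
        T.majorant (fun η => ‖g η‖ₑ) ξ) → ∀ ξ, ‖ftild (FPsi d μ g T τ) ξ‖ₑ ≤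
        ENNReal.ofReal τ ^ T.internal * (fun ξ => T.majorant (fun η => ‖g η‖ₑ) (-ξ)) ξ := by
      intro T τ h ξ
      rw [enorm_ftild]
      exact h _
    rw [FPsi, enorm_mul, enorm_mul, enorm_mul, hI, hμ', norm_exp_I_mul_phase, one_mul, one_mul,
      one_mul, Tree5.internal, pow_succ' (ENNReal.ofReal t), mul_assoc (ENNReal.ofReal t)]
    refine enorm_intervalIntegral_le_mul ht fun τ hτ => ?_
    have hτ0 := hτ.1.le
    have hphase := norm_exp_I_mul_phase (-τ) ξ
    rw [Complex.ofReal_neg, neg_mul, mul_neg] at hphase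
    rw [enorm_mul, hphase, one_mul]
    refine (enorm_fconv_le (by fun_prop) m5 (enorm_fconv_le (by fun_prop) (by fun_prop)
      (enorm_fconv_le (by fun_prop) m3 (enorm_fconv_le m1 (by fun_prop) (h1 τ hτ0)
        (tild T2 τ (h2 τ hτ0))) (h3 τ hτ0)) (tild T4 τ (h4 τ hτ0))) (h5 τ hτ0) ξ).trans ?_
    rw [← pow_add, ← pow_add, ← pow_add, ← pow_add]
    exact mul_le_mul_left (pow_le_pow_left₀ zero_le (ENNReal.ofReal_le_ofReal hτ.2) _) _

theorem Tree5.exists_majorant_le_add {h p u : Ed d → ℝ≥0∞} (hh : Measurable h) (hp : Measurable p)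
    (hu : Measurable u) (hpu : ∀ ξ, h ξ ≤ p ξ + u ξ) {c : ℝ≥0∞} (hc : ∀ ξ, p ξ ≤ c) (T : Tree5) :
    ∃ P U : Ed d → ℝ≥0∞, Measurable P ∧ Measurable U ∧ (∀ ξ, T.majorant h ξ ≤ P ξ + U ξ) ∧
      (∀ ξ, P ξ ≤ (∫⁻ ξ, h ξ) ^ (4 * T.internal) * c) ∧
      ∫⁻ ξ, P ξ ≤ (∫⁻ ξ, h ξ) ^ (4 * T.internal) * ∫⁻ ξ, p ξ ∧
      ∫⁻ ξ, U ξ ^ 2 ≤ ((∫⁻ ξ, h ξ) ^ (4 * T.internal)) ^ 2 * ∫⁻ ξ, u ξ ^ 2 := by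
  induction T with
  | leaf => exact ⟨p, u, hp, hu, hpu, by simpa [internal] using hc, by simp [internal],
      by simp [internal]⟩
  | node T1 T2 T3 T4 T5 h1 h2 h3 h4 h5 =>
    obtain ⟨P, U, mP, mU, hPU, hPc, hP, hU⟩ := h5
    have m := fun T : Tree5 => T.measurable_majorant hh
    have m1 := m T1
    have m2 := m T2
    have m3 := m T3
    have m4 := m T4
    set K := ((T1.majorant h ⋆ₗ fun η => T2.majorant h (-η)) ⋆ₗ T3.majorant h) ⋆ₗ
        fun η => T4.majorant h (-η) with hK
    have mK : Measurable K := by fun_prop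
    have iK : ∫⁻ ξ, K ξ = (∫⁻ ξ, h ξ) ^ (4 * (T1.internal + T2.internal + T3.internal
        + T4.internal + 1)) := by
      rw [hK, lintegral_lconvolution (by fun_prop) (by fun_prop),
        lintegral_lconvolution (by fun_prop) (by fun_prop),
        lintegral_lconvolution (by fun_prop) (by fun_prop),
        lintegral_neg_eq_self (fun η => T2.majorant h η),
        lintegral_neg_eq_self (fun η => T4.majorant h η), lintegral_majorant hh,
        lintegral_majorant hh, lintegral_majorant hh, lintegral_majorant hh]
      ring
    have hpow : (∫⁻ ξ, h ξ) ^ (4 * (node T1 T2 T3 T4 T5).internal)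
        = (∫⁻ ξ, K ξ) * (∫⁻ ξ, h ξ) ^ (4 * T5.internal) := by
      rw [iK, internal]
      ring
    rw [hpow]
    refine ⟨K ⋆ₗ P, K ⋆ₗ U, by fun_prop, by fun_prop, fun ξ => ?_, fun ξ => ?_, ?_, ?_⟩
    · change (K ⋆ₗ T5.majorant h) ξ ≤ _
      simp only [lconvolution_def]
      rw [← lintegral_add_left (by fun_prop)]
      refine lintegral_mono fun η => ?_
      rw [← mul_add]
      exact mul_le_mul_right (hPU _) _
    · rw [mul_assoc]
      exact lconvolution_le_of_le mK hPc ξ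
    · rw [lintegral_lconvolution mK mP, mul_assoc]
      exact mul_le_mul_right hP _
    · refine (lintegral_lconvolution_sq_le mK mU).trans ?_
      rw [mul_pow, mul_assoc]
      exact mul_le_mul_right hU _

end Majorant

section TreeCount

/-- The preorder word of a tree: `true` for a node, `false` for a leaf. -/
def Tree5.word : Tree5 → List Bool
  | .leaf => [false]
  | .node a b c d e => true :: (a.word ++ (b.word ++ (c.word ++ (d.word ++ e.word))))

theorem Tree5.length_word (T : Tree5) : T.word.length = 5 * T.internal + 1 := by
  induction T with
  | leaf => rfl
  | node a b c d e h1 h2 h3 h4 h5 =>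
    simp only [word, internal, List.length_cons, List.length_append]
    lia

theorem Tree5.word_append_inj (T : Tree5) :
    ∀ (T' : Tree5) (l l' : List Bool), T.word ++ l = T'.word ++ l' → T = T' ∧ l = l' := by
  induction T with
  | leaf =>
    intro T' l l' h
    cases T' <;> simp_all [word]
  | node a b c d e h1 h2 h3 h4 h5 =>
    intro T' l l' h
    cases T' with
    | leaf => simp [word] at h
    | node a' b' c' d' e' =>
      simp only [word, List.cons_append, List.append_assoc, List.cons.injEq, true_and] at h
      obtain ⟨ha, g1⟩ := h1 _ _ _ h
      obtain ⟨hb, g2⟩ := h2 _ _ _ g1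
      obtain ⟨hc, g3⟩ := h3 _ _ _ g2
      obtain ⟨hd, g4⟩ := h4 _ _ _ g3
      obtain ⟨he, g5⟩ := h5 _ _ _ g4
      exact ⟨by rw [ha, hb, hc, hd, he], g5⟩

/-- The preorder word of a tree with `j` nodes, as a vector of length `5 * j + 1`. -/
def Tree5.wordVector (j : ℕ) (T : {T : Tree5 // T.internal = j}) :
    List.Vector Bool (5 * j + 1) :=
  ⟨T.1.word, by rw [T.1.length_word, T.2]⟩

theorem Tree5.wordVector_injective (j : ℕ) : Function.Injective (Tree5.wordVector j) := by
  intro T T' h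
  have h' : T.1.word = T'.1.word := congrArg Subtype.val h
  exact Subtype.ext (T.1.word_append_inj T'.1 [] [] (by simp [h'])).1

instance Tree5.finite_internal_eq (j : ℕ) : Finite {T : Tree5 // T.internal = j} :=
  Finite.of_injective _ (Tree5.wordVector_injective j)

theorem Tree5.card_internal_eq_le (j : ℕ) (hj : 1 ≤ j) [Fintype {T : Tree5 // T.internal = j}] :
    Fintype.card {T : Tree5 // T.internal = j} ≤ 64 ^ j := by
  have h := Fintype.card_le_of_injective _ (Tree5.wordVector_injective j)
  rw [card_vector, Fintype.card_bool] at h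
  calc _ ≤ 2 ^ (5 * j + 1) := h
    _ ≤ 2 ^ (6 * j) := Nat.pow_le_pow_right (by norm_num) (by lia)
    _ = 64 ^ j := by rw [pow_mul]; norm_num

end TreeCount

section Weight

variable {d : ℕ}

/-- The Sobolev weight `(1 + |ξ|²)^s` with values in `ℝ≥0∞`. -/
def sobolevWeight (d : ℕ) (s : ℝ) (ξ : Ed d) : ℝ≥0∞ := ENNReal.ofReal ((1 + ‖ξ‖ ^ 2) ^ s)

theorem measurable_sobolevWeight (s : ℝ) : Measurable (sobolevWeight d s) := by
  unfold sobolevWeight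
  fun_prop

theorem sobolevWeight_le_one {s : ℝ} (hs : s ≤ 0) (ξ : Ed d) : sobolevWeight d s ξ ≤ 1 := by
  rw [sobolevWeight, ← ENNReal.ofReal_one]
  exact ENNReal.ofReal_le_ofReal
    (Real.rpow_le_one_of_one_le_of_nonpos (by nlinarith [sq_nonneg ‖ξ‖]) hs)

theorem one_add_sq_rpow_le {s y : ℝ} (hs : s ≤ 0) (hy : 0 < y) :
    (1 + y ^ 2) ^ s ≤ y ^ (2 * s) := by
  rw [Real.rpow_mul hy.le, Real.rpow_two]
  exact Real.rpow_le_rpow_of_nonpos (by positivity) (by linarith) hs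

theorem lintegral_ball_sobolevWeight (hd : 0 < d) (s : ℝ) {A : ℝ} (hA : 0 < A) :
    ∫⁻ ξ in Metric.ball 0 A, sobolevWeight d s ξ = ENNReal.ofReal
      (d * volume.real (Metric.ball (0 : Ed d) 1) *
        ∫ y in (0 : ℝ)..A, y ^ (d - 1) * (1 + y ^ 2) ^ s) := by
  have : Nontrivial (Ed d) := by
    have : Nonempty (Fin d) := ⟨⟨0, hd⟩⟩
    infer_instance
  have hcont : Continuous fun ξ : Ed d => (1 + ‖ξ‖ ^ 2) ^ s :=
    Continuous.rpow_const (by fun_prop) fun ξ => Or.inl (by positivity)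
  have hint : IntegrableOn (fun ξ : Ed d => (1 + ‖ξ‖ ^ 2) ^ s) (Metric.ball 0 A) :=
    (hcont.continuousOn.integrableOn_compact (isCompact_closedBall 0 A)).mono_set
      Metric.ball_subset_closedBall
  unfold sobolevWeight
  rw [← ofReal_integral_eq_lintegral_ofReal hint (ae_of_all _ fun ξ => by positivity)]
  congr 1
  have hind : (fun ξ : Ed d => (Metric.ball (0 : Ed d) A).indicator
      (fun ξ : Ed d => (1 + ‖ξ‖ ^ 2) ^ s) ξ)
      = fun ξ => (Iio A).indicator (fun y : ℝ => (1 + y ^ 2) ^ s) ‖ξ‖ := by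
    ext ξ
    simp [indicator]
  rw [← integral_indicator measurableSet_ball, hind, integral_fun_norm_addHaar,
    finrank_euclideanSpace_fin, nsmul_eq_mul, smul_eq_mul, mul_assoc,
    intervalIntegral.integral_of_le hA.le, integral_Ioc_eq_integral_Ioo]
  congr 2
  have hind' : ∀ y : ℝ, y ^ (d - 1) • (Iio A).indicator (fun y : ℝ => (1 + y ^ 2) ^ s) y
      = (Iio A).indicator (fun y : ℝ => y ^ (d - 1) * (1 + y ^ 2) ^ s) y := by
    intro y
    by_cases hy : y < A <;> simp [indicator, hy]
  simp only [hind']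
  rw [setIntegral_indicator measurableSet_Iio, Ioi_inter_Iio]

theorem lintegral_sobolevWeight_lt_top {s : ℝ} (hs : s < -((d : ℝ) / 2)) :
    ∫⁻ ξ, sobolevWeight d s ξ < ⊤ := by
  have h := integrable_rpow_neg_one_add_norm_sq (E := Ed d) (μ := volume) (r := -2 * s)
    (by rw [finrank_euclideanSpace_fin]; linarith)
  have hs' : -(-2 * s) / 2 = s := by ring
  rw [hs'] at h
  exact h.lintegral_lt_top

theorem continuous_pow_mul_one_add_sq_rpow (n : ℕ) (s : ℝ) :
    Continuous fun y : ℝ => y ^ n * (1 + y ^ 2) ^ s :=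
  Continuous.mul (by fun_prop)
    (Continuous.rpow_const (by fun_prop) fun y => Or.inl (by positivity))

theorem radial_integral_le_rpow (hd : 0 < d) {s A : ℝ} (hs : s < 0) (hds : -((d : ℝ) / 2) < s)
    (hA : 0 < A) :
    ∫ y in (0 : ℝ)..A, y ^ (d - 1) * (1 + y ^ 2) ^ s ≤ A ^ (d + 2 * s) / (d + 2 * s) := by
  have h : ∫ y in (0 : ℝ)..A, y ^ ((d : ℝ) - 1 + 2 * s) = A ^ (d + 2 * s) / (d + 2 * s) := by
    rw [integral_rpow (Or.inl (by linarith))]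
    have he : (d : ℝ) - 1 + 2 * s + 1 = d + 2 * s := by ring
    rw [he, Real.zero_rpow (by linarith), sub_zero]
  rw [← h]
  refine intervalIntegral.integral_mono_on_of_le_Ioo hA.le
    ((continuous_pow_mul_one_add_sq_rpow _ _).intervalIntegrable _ _)
    (intervalIntegral.intervalIntegrable_rpow' (by linarith)) fun y hy => ?_
  rw [Real.rpow_add hy.1, ← Nat.cast_pred hd, Real.rpow_natCast]
  exact mul_le_mul_of_nonneg_left (one_add_sq_rpow_le hs.le hy.1) (pow_nonneg hy.1.le _)

theorem radial_integral_le_log (hd : 0 < d) {A : ℝ} (hA : 2 ≤ A) :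
    ∫ y in (0 : ℝ)..A, y ^ (d - 1) * (1 + y ^ 2) ^ (-((d : ℝ) / 2)) ≤ 4 * Real.log A := by
  have hA0 : (0 : ℝ) ≤ A := by linarith
  have h : ∫ y in (0 : ℝ)..A, 2 * (1 + y)⁻¹ = 2 * Real.log (1 + A) := by
    rw [intervalIntegral.integral_const_mul,
      intervalIntegral.integral_comp_add_left (fun y : ℝ => y⁻¹) 1,
      integral_inv_of_pos (by norm_num) (by linarith)]
    simp
  calc _ ≤ ∫ y in (0 : ℝ)..A, 2 * (1 + y)⁻¹ := by
        refine intervalIntegral.integral_mono_on hA0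
          ((continuous_pow_mul_one_add_sq_rpow _ _).intervalIntegrable _ _) ?_ fun y hy => ?_
        · refine ContinuousOn.intervalIntegrable fun y hy => ?_
          rw [uIcc_of_le hA0] at hy
          have : 1 + y ≠ 0 := by linarith [hy.1]
          fun_prop (disch := assumption)
        · have hy0 := hy.1
          have hb : (0 : ℝ) < 1 + y ^ 2 := by positivity
          have hyd : y ^ (d - 1) ≤ (1 + y ^ 2) ^ (((d : ℝ) - 1) / 2) := by
            calc y ^ (d - 1) = (y ^ 2) ^ (((d : ℝ) - 1) / 2) := by
                  rw [← Real.rpow_natCast y 2, ← Real.rpow_mul hy0, ← Real.rpow_natCast,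
                    Nat.cast_pred hd]
                  congr 1
                  push_cast
                  ring
              _ ≤ _ := Real.rpow_le_rpow (by positivity) (by linarith)
                  (by rw [← Nat.cast_pred hd]; positivity)
          calc _ ≤ (1 + y ^ 2) ^ (((d : ℝ) - 1) / 2) * (1 + y ^ 2) ^ (-((d : ℝ) / 2)) :=
                mul_le_mul_of_nonneg_right hyd (by positivity)
            _ = (√(1 + y ^ 2))⁻¹ := by
                rw [← Real.rpow_add hb, Real.sqrt_eq_rpow, ← Real.rpow_neg hb.le]
                congr 1
                ring
            _ ≤ ((1 + y) / 2)⁻¹ := by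
                refine inv_anti₀ (by linarith) (Real.le_sqrt_of_sq_le ?_)
                nlinarith [sq_nonneg (y - 1)]
            _ = 2 * (1 + y)⁻¹ := by rw [inv_div, div_eq_mul_inv]
    _ = 2 * Real.log (1 + A) := h
    _ ≤ 2 * Real.log (A ^ 2) := by
        have : Real.log (1 + A) ≤ Real.log (A ^ 2) :=
          Real.log_le_log (by linarith) (by nlinarith)
        linarith
    _ = _ := by
        rw [Real.log_pow]
        push_cast
        ring

theorem fS_nonneg (d : ℕ) (s : ℝ) {A : ℝ} (hA : 2 ≤ A) : 0 ≤ fS d s A := by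
  have := Real.log_nonneg (by linarith : (1 : ℝ) ≤ A)
  unfold fS
  split_ifs <;> positivity

theorem exists_sobolevWeight_bound (hd : 0 < d) {s : ℝ} (hs : s < 0) :
    ∃ C > (0 : ℝ), ∀ A : ℝ, 2 ≤ A →
      ∫⁻ ξ in Metric.ball 0 A, sobolevWeight d s ξ ≤ ENNReal.ofReal (C * fS d s A ^ 2) ∧
      A ^ (2 * s) * A ^ d ≤ C * fS d s A ^ 2 := by
  have hpow : ∀ A : ℝ, 0 < A → A ^ (2 * s) * A ^ d = A ^ (d + 2 * s) := fun A hA => by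
    rw [Real.rpow_add hA, Real.rpow_natCast, mul_comm]
  set V := d * volume.real (Metric.ball (0 : Ed d) 1) with hV
  have hV0 : 0 ≤ V := by positivity
  rcases lt_trichotomy s (-((d : ℝ) / 2)) with hlt | heq | hgt
  · refine ⟨(∫⁻ ξ, sobolevWeight d s ξ).toReal + 1, by positivity, fun A hA => ?_⟩
    have hfS : fS d s A = 1 := by rw [fS, if_pos hlt]
    have htop := (lintegral_sobolevWeight_lt_top hlt).ne
    have h1 : A ^ (d + 2 * s) ≤ 1 :=
      Real.rpow_le_one_of_one_le_of_nonpos (by linarith) (by linarith)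
    rw [hpow A (by linarith), hfS, one_pow, mul_one]
    refine ⟨(setLIntegral_le_lintegral _ _).trans ?_, h1.trans ?_⟩
    · rw [← ENNReal.ofReal_toReal htop]
      exact ENNReal.ofReal_le_ofReal (by simp)
    · simp
  · refine ⟨4 * V + 2, by positivity, fun A hA => ?_⟩
    have hlog : Real.log 2 ≤ Real.log A := Real.log_le_log (by norm_num) hA
    have hlog2 := Real.log_two_gt_d9
    have hfS : fS d s A ^ 2 = Real.log A := by
      rw [fS, if_neg heq.not_lt, if_pos heq, ← Real.sqrt_eq_rpow, Real.sq_sqrt (by linarith)]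
    rw [hpow A (by linarith), hfS, lintegral_ball_sobolevWeight hd s (by linarith), ← hV]
    constructor
    · refine ENNReal.ofReal_le_ofReal ?_
      have := mul_le_mul_of_nonneg_left (radial_integral_le_log hd hA) hV0
      rw [← heq] at this
      nlinarith
    · have : (d : ℝ) + 2 * s = 0 := by rw [heq]; ring
      rw [this, Real.rpow_zero]
      nlinarith
  · have hpos : 0 < (d : ℝ) + 2 * s := by linarith
    refine ⟨V / (d + 2 * s) + 1, by positivity, fun A hA => ?_⟩
    have hA0 : 0 < A := by linarith
    have hfS : fS d s A ^ 2 = A ^ (d + 2 * s) := by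
      rw [fS, if_neg hgt.le.not_gt, if_neg hgt.ne', ← Real.rpow_natCast, ← Real.rpow_mul hA0.le]
      congr 1
      push_cast
      ring
    have hAp : 0 < A ^ (d + 2 * s) := Real.rpow_pos_of_pos hA0 _
    rw [hpow A hA0, hfS, lintegral_ball_sobolevWeight hd s hA0, ← hV]
    constructor
    · refine ENNReal.ofReal_le_ofReal ?_
      have := mul_le_mul_of_nonneg_left (radial_integral_le_rpow hd hs hgt hA0) hV0
      refine this.trans ?_
      rw [add_mul, mul_div_assoc', div_mul_eq_mul_div]
      linarith
    · have : 0 ≤ V / (d + 2 * s) := by positivity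
      nlinarith

/-- The weighted `L²` bound for a function controlled in `L^∞` and in `L¹`. -/
theorem lintegral_sobolevWeight_mul_sq_le {s : ℝ} (hs : s ≤ 0) {P : Ed d → ℝ≥0∞}
    (hP : Measurable P) {c : ℝ≥0∞} (hc : ∀ ξ, P ξ ≤ c) {A : ℝ} (hA : 0 < A) :
    ∫⁻ ξ, sobolevWeight d s ξ * P ξ ^ 2 ≤
      c ^ 2 * (∫⁻ ξ in Metric.ball 0 A, sobolevWeight d s ξ)
        + ENNReal.ofReal (A ^ (2 * s)) * c * ∫⁻ ξ, P ξ := by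
  have mW := measurable_sobolevWeight (d := d) s
  rw [← lintegral_add_compl _ (measurableSet_ball (x := (0 : Ed d)) (ε := A))]
  refine add_le_add ?_ ?_
  · rw [← lintegral_const_mul _ mW]
    refine lintegral_mono fun ξ => ?_
    rw [mul_comm]
    exact mul_le_mul_left (pow_le_pow_left₀ zero_le (hc ξ) 2) _
  · calc _ ≤ ∫⁻ ξ in (Metric.ball (0 : Ed d) A)ᶜ, ENNReal.ofReal (A ^ (2 * s)) * c * P ξ := by
          refine setLIntegral_mono (by fun_prop) fun ξ hξ => ?_
          have hξ' : A ≤ ‖ξ‖ := by simpa using hξ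
          rw [sq, ← mul_assoc]
          refine mul_le_mul_left (mul_le_mul' (ENNReal.ofReal_le_ofReal ?_) (hc ξ)) _
          exact (one_add_sq_rpow_le hs (hA.trans_le hξ')).trans
            (Real.rpow_le_rpow_of_nonpos hA hξ' (by linarith))
      _ ≤ ∫⁻ ξ, ENNReal.ofReal (A ^ (2 * s)) * c * P ξ := setLIntegral_le_lintegral _ _
      _ = _ := lintegral_const_mul _ hP

end Weight

theorem Tree5.lintegral_sobolevWeight_mul_majorant_sq_le {d : ℕ} {s : ℝ} (hs : s ≤ 0)
    {h p u : Ed d → ℝ≥0∞} (hh : Measurable h) (hp : Measurable p) (hu : Measurable u)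
    (hpu : ∀ ξ, h ξ ≤ p ξ + u ξ) {A R M L B : ℝ} (hA : 0 < A) (hR : 0 ≤ R) (hM : 0 ≤ M)
    (hB : 0 ≤ B) (h_int : ∫⁻ ξ, h ξ ≤ ENNReal.ofReal M)
    (hp_sup : ∀ ξ, p ξ ≤ ENNReal.ofReal (2 * R))
    (hp_int : ∫⁻ ξ, p ξ ≤ ENNReal.ofReal (2 * (R * A ^ d)))
    (hu_sq : ∫⁻ ξ, u ξ ^ 2 ≤ ENNReal.ofReal (L ^ 2))
    (hball : ∫⁻ ξ in Metric.ball 0 A, sobolevWeight d s ξ ≤ ENNReal.ofReal B)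
    (hAB : A ^ (2 * s) * A ^ d ≤ B) (T : Tree5) :
    ∫⁻ ξ, sobolevWeight d s ξ * T.majorant h ξ ^ 2 ≤
      ENNReal.ofReal (2 * (M ^ (4 * T.internal)) ^ 2 * (8 * B * R ^ 2 + L ^ 2)) := by
  obtain ⟨P, U, mP, mU, hPU, hPc, hP, hU⟩ := T.exists_majorant_le_add hh hp hu hpu hp_sup
  have mW := measurable_sobolevWeight (d := d) s
  set m := M ^ (4 * T.internal) with hm
  have hm0 : 0 ≤ m := by positivity
  have hJ : (∫⁻ ξ, h ξ) ^ (4 * T.internal) ≤ ENNReal.ofReal m := by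
    rw [hm, ENNReal.ofReal_pow hM]
    exact pow_le_pow_left₀ zero_le h_int _
  have hPsup : ∀ ξ, P ξ ≤ ENNReal.ofReal (m * (2 * R)) := fun ξ => by
    rw [ENNReal.ofReal_mul hm0]
    exact (hPc ξ).trans (mul_le_mul_left hJ _)
  have hPint : ∫⁻ ξ, P ξ ≤ ENNReal.ofReal (m * (2 * (R * A ^ d))) := by
    rw [ENNReal.ofReal_mul hm0]
    exact hP.trans (mul_le_mul' hJ hp_int)
  have hWP : ∫⁻ ξ, sobolevWeight d s ξ * P ξ ^ 2 ≤ ENNReal.ofReal (m ^ 2 * (8 * B * R ^ 2)) := by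
    have hA' : (0 : ℝ) ≤ A ^ (2 * s) := by positivity
    calc _ ≤ ENNReal.ofReal (m * (2 * R)) ^ 2 * ENNReal.ofReal B
          + ENNReal.ofReal (A ^ (2 * s)) * ENNReal.ofReal (m * (2 * R)) *
            ENNReal.ofReal (m * (2 * (R * A ^ d))) :=
          (lintegral_sobolevWeight_mul_sq_le hs mP hPsup hA).trans
            (add_le_add (mul_le_mul_right hball _) (mul_le_mul_right hPint _))
      _ = ENNReal.ofReal (m ^ 2 * (4 * R ^ 2) * (B + A ^ (2 * s) * A ^ d)) := by
          rw [← ENNReal.ofReal_pow (by positivity), ← ENNReal.ofReal_mul (by positivity),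
            ← ENNReal.ofReal_mul (by positivity), ← ENNReal.ofReal_mul (by positivity),
            ← ENNReal.ofReal_add (by positivity) (by positivity)]
          congr 1
          ring
      _ ≤ _ := by
          refine ENNReal.ofReal_le_ofReal ?_
          have := mul_le_mul_of_nonneg_left hAB (by positivity : 0 ≤ m ^ 2 * (4 * R ^ 2))
          linarith
  have hUU : ∫⁻ ξ, U ξ ^ 2 ≤ ENNReal.ofReal (m ^ 2 * L ^ 2) := by
    rw [ENNReal.ofReal_mul (by positivity), ENNReal.ofReal_pow hm0]
    exact hU.trans (mul_le_mul' (pow_le_pow_left₀ zero_le hJ 2) hu_sq)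
  have hsq : ∀ a b : ℝ≥0∞, (a + b) ^ 2 ≤ 2 * (a ^ 2 + b ^ 2) := fun a b => by
    have := ENNReal.rpow_add_le_mul_rpow_add_rpow a b (p := 2) (by norm_num)
    norm_num at this
    exact this
  calc _ ≤ ∫⁻ ξ, 2 * (sobolevWeight d s ξ * P ξ ^ 2 + U ξ ^ 2) := by
        refine lintegral_mono fun ξ => ?_
        calc _ ≤ sobolevWeight d s ξ * (2 * (P ξ ^ 2 + U ξ ^ 2)) :=
              mul_le_mul_right ((pow_le_pow_left₀ zero_le (hPU ξ) 2).trans (hsq _ _)) _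
          _ = 2 * (sobolevWeight d s ξ * P ξ ^ 2 + sobolevWeight d s ξ * U ξ ^ 2) := by ring
          _ ≤ _ := by
              gcongr
              exact mul_le_of_le_one_left zero_le (sobolevWeight_le_one hs ξ)
    _ = 2 * ((∫⁻ ξ, sobolevWeight d s ξ * P ξ ^ 2) + ∫⁻ ξ, U ξ ^ 2) := by
        rw [lintegral_const_mul _ (by fun_prop), lintegral_add_left (by fun_prop)]
    _ ≤ 2 * (ENNReal.ofReal (m ^ 2 * (8 * B * R ^ 2)) + ENNReal.ofReal (m ^ 2 * L ^ 2)) := by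
        gcongr
    _ = _ := by
        rw [← ENNReal.ofReal_add (by positivity) (by positivity),
          ← ENNReal.ofReal_ofNat 2, ← ENNReal.ofReal_mul (by positivity)]
        congr 1
        ring

theorem hSobHat_le_of_lintegral_le {d : ℕ} {s : ℝ} {g : Ed d → ℂ} {b : ℝ} (hb : 0 ≤ b)
    (h : ∫⁻ ξ, sobolevWeight d s ξ * ‖g ξ‖ₑ ^ 2 ≤ ENNReal.ofReal (b ^ 2)) : hSobHat s g ≤ b := by
  have h1 : ‖∫ ξ : Ed d, (1 + ‖ξ‖ ^ 2) ^ s * ‖g ξ‖ ^ 2‖ₑ ≤ ENNReal.ofReal (b ^ 2) := by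
    refine (enorm_integral_le_lintegral_enorm _).trans (le_of_eq_of_le ?_ h)
    congr 1 with ξ
    rw [enorm_mul, enorm_pow, enorm_norm, sobolevWeight, Real.enorm_of_nonneg (by positivity)]
  have h0 : 0 ≤ ∫ ξ : Ed d, (1 + ‖ξ‖ ^ 2) ^ s * ‖g ξ‖ ^ 2 :=
    integral_nonneg fun ξ => by positivity
  rw [Real.enorm_of_nonneg h0, ENNReal.ofReal_le_ofReal_iff (by positivity)] at h1
  rw [hSobHat, ← Real.sqrt_eq_rpow]
  exact Real.sqrt_le_iff.2 ⟨hb, h1⟩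

theorem lintegral_sobolevWeight_mul_enorm_FTheta_sq_le {d : ℕ} {s μ : ℝ} (hμ : ‖μ‖ₑ = 1)
    {g : Ed d → ℂ} (hg : Measurable g) {j : ℕ} (hj : 1 ≤ j) {b t : ℝ} (ht : 0 ≤ t)
    (hb : ∀ T : Tree5, T.internal = j →
      ∫⁻ ξ, sobolevWeight d s ξ * T.majorant (fun η => ‖g η‖ₑ) ξ ^ 2 ≤ ENNReal.ofReal b) :
    ∫⁻ ξ, sobolevWeight d s ξ * ‖FTheta d μ g j t ξ‖ₑ ^ 2 ≤
      ENNReal.ofReal ((64 ^ j * t ^ j) ^ 2 * b) := by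
  have := Fintype.ofFinite {T : Tree5 // T.internal = j}
  have mW := measurable_sobolevWeight (d := d) s
  have mG := fun T : Tree5 => T.measurable_majorant hg.enorm
  set κ : ℝ≥0∞ := (Fintype.card {T : Tree5 // T.internal = j} : ℝ≥0∞) with hκ
  have hκle : κ ≤ ENNReal.ofReal (64 ^ j) := by
    rw [hκ, ENNReal.ofReal_pow (by norm_num), ENNReal.ofReal_ofNat]
    exact_mod_cast Tree5.card_internal_eq_le j hj
  have hpt : ∀ ξ, ‖FTheta d μ g j t ξ‖ₑ ^ 2 ≤ (ENNReal.ofReal t ^ j) ^ 2 *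
      (κ * ∑ T : {T : Tree5 // T.internal = j}, T.1.majorant (fun η => ‖g η‖ₑ) ξ ^ 2) := by
    intro ξ
    have h1 : ‖FTheta d μ g j t ξ‖ₑ ≤ ENNReal.ofReal t ^ j *
        ∑ T : {T : Tree5 // T.internal = j}, T.1.majorant (fun η => ‖g η‖ₑ) ξ := by
      rw [FTheta, tsum_fintype, Finset.mul_sum]
      refine (enorm_sum_le _ _).trans (Finset.sum_le_sum fun T _ => ?_)
      have := enorm_FPsi_le hμ hg T.1 t ht ξ
      rwa [T.2] at this
    refine (pow_le_pow_left₀ zero_le h1 2).trans ?_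
    rw [mul_pow]
    refine mul_le_mul_right ?_ _
    have h2 := ENNReal.rpow_sum_le_const_mul_sum_rpow Finset.univ
      (fun T : {T : Tree5 // T.internal = j} => T.1.majorant (fun η => ‖g η‖ₑ) ξ)
      (p := 2) (by norm_num)
    norm_num at h2
    exact h2
  calc _ ≤ ∫⁻ ξ, (ENNReal.ofReal t ^ j) ^ 2 * (κ * ∑ T : {T : Tree5 // T.internal = j},
          sobolevWeight d s ξ * T.1.majorant (fun η => ‖g η‖ₑ) ξ ^ 2) := by
        refine lintegral_mono fun ξ => (mul_le_mul_right (hpt ξ) _).trans_eq ?_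
        rw [← Finset.mul_sum]
        ring
    _ = (ENNReal.ofReal t ^ j) ^ 2 * (κ * ∑ T : {T : Tree5 // T.internal = j},
          ∫⁻ ξ, sobolevWeight d s ξ * T.1.majorant (fun η => ‖g η‖ₑ) ξ ^ 2) := by
        rw [lintegral_const_mul _ (by fun_prop), lintegral_const_mul _ (by fun_prop),
          lintegral_finsetSum _ (by fun_prop)]
    _ ≤ (ENNReal.ofReal t ^ j) ^ 2 * (κ * ∑ _T : {T : Tree5 // T.internal = j},
          ENNReal.ofReal b) := by
        gcongr with T
        exact hb T.1 T.2
    _ = (ENNReal.ofReal t ^ j) ^ 2 * (κ ^ 2 * ENNReal.ofReal b) := by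
        rw [Finset.sum_const, Finset.card_univ, nsmul_eq_mul, ← hκ]
        ring
    _ ≤ (ENNReal.ofReal t ^ j) ^ 2 * (ENNReal.ofReal (64 ^ j) ^ 2 * ENNReal.ofReal b) := by
        gcongr
    _ = _ := by
        rw [← ENNReal.ofReal_pow ht, ← ENNReal.ofReal_pow (by positivity),
          ← ENNReal.ofReal_pow (by positivity), ← ENNReal.ofReal_mul (by positivity),
          ← ENNReal.ofReal_mul (by positivity)]
        congr 1
        ring

section Perturbation

variable {d : ℕ}

theorem measurableSet_QA (d : ℕ) (A : ℝ) : MeasurableSet (QA d A) := by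
  have : QA d A = ⋂ i, (fun ξ : Ed d => ξ i) ⁻¹' Ico (-(A / 2)) (A / 2) := by
    ext
    simp [QA]
  rw [this]
  exact MeasurableSet.iInter fun i => measurableSet_Ico.preimage (by fun_prop)

theorem volume_QA (d : ℕ) {A : ℝ} (hA : 0 ≤ A) : volume (QA d A) = ENNReal.ofReal (A ^ d) := by
  have h : QA d A = (WithLp.ofLp : Ed d → Fin d → ℝ) ⁻¹'
      univ.pi fun _ => Ico (-(A / 2)) (A / 2) := by
    ext
    simp [QA]
  rw [h, (PiLp.volume_preserving_ofLp (Fin d)).measure_preimage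
    (MeasurableSet.univ_pi fun _ => measurableSet_Ico).nullMeasurableSet, Real.volume_pi_Ico]
  simp [ENNReal.ofReal_pow hA]

theorem measurableSet_translate_QA (A : ℝ) (a : Ed d) : MeasurableSet {ξ | ξ - a ∈ QA d A} :=
  (measurableSet_QA d A).preimage (by fun_prop)

theorem enorm_cubeIndC (A : ℝ) (a ξ : Ed d) :
    ‖cubeIndC d A a ξ‖ₑ = {ξ | ξ - a ∈ QA d A}.indicator 1 ξ := by
  rw [cubeIndC, enorm_indicator_eq_indicator_enorm]
  simp [indicator]

theorem lintegral_enorm_cubeIndC {A : ℝ} (hA : 0 ≤ A) (a : Ed d) :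
    ∫⁻ ξ, ‖cubeIndC d A a ξ‖ₑ = ENNReal.ofReal (A ^ d) := by
  simp only [enorm_cubeIndC]
  rw [lintegral_indicator_one (measurableSet_translate_QA A a), ← volume_QA d hA]
  exact (measurePreserving_sub_right volume a).measure_preimage
    (measurableSet_QA d A).nullMeasurableSet

theorem measurable_cubeIndC (A : ℝ) (a : Ed d) : Measurable (cubeIndC d A a) :=
  measurable_const.indicator (measurableSet_translate_QA A a)

theorem measurable_phiHat (hd : 0 < d) (R A N : ℝ) : Measurable (phiHat d hd R A N) := by
  have h1 := measurable_cubeIndC (d := d) A (N • e1 d hd)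
  have h2 := measurable_cubeIndC (d := d) A ((2 * N) • e1 d hd)
  unfold phiHat
  fun_prop

theorem enorm_phiHat_le_add (hd : 0 < d) {R : ℝ} (hR : 0 ≤ R) (A N : ℝ) (ξ : Ed d) :
    ‖phiHat d hd R A N ξ‖ₑ ≤ ENNReal.ofReal R *
      (‖cubeIndC d A (N • e1 d hd) ξ‖ₑ + ‖cubeIndC d A ((2 * N) • e1 d hd) ξ‖ₑ) := by
  rw [phiHat, enorm_mul, ← ofReal_norm (R : ℂ), Complex.norm_real, Real.norm_of_nonneg hR]
  exact mul_le_mul_right (enorm_add_le _ _) _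

theorem enorm_phiHat_le (hd : 0 < d) {R : ℝ} (hR : 0 ≤ R) (A N : ℝ) (ξ : Ed d) :
    ‖phiHat d hd R A N ξ‖ₑ ≤ ENNReal.ofReal (2 * R) := by
  have h : ∀ a : Ed d, ‖cubeIndC d A a ξ‖ₑ ≤ 1 := fun a => by
    rw [enorm_cubeIndC]
    exact indicator_le_self' (by simp) ξ
  calc _ ≤ ENNReal.ofReal R * (1 + 1) :=
        (enorm_phiHat_le_add hd hR A N ξ).trans (mul_le_mul_right (add_le_add (h _) (h _)) _)
    _ = _ := by
        rw [one_add_one_eq_two, ENNReal.ofReal_mul zero_le_two, ENNReal.ofReal_ofNat, mul_comm]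

theorem lintegral_enorm_phiHat_le (hd : 0 < d) {R A : ℝ} (hR : 0 ≤ R) (hA : 0 ≤ A) (N : ℝ) :
    ∫⁻ ξ, ‖phiHat d hd R A N ξ‖ₑ ≤ ENNReal.ofReal (2 * (R * A ^ d)) := by
  have h1 := (measurable_cubeIndC (d := d) A (N • e1 d hd)).enorm
  have h2 := (measurable_cubeIndC (d := d) A ((2 * N) • e1 d hd)).enorm
  calc _ ≤ _ := lintegral_mono (enorm_phiHat_le_add hd hR A N)
    _ = ENNReal.ofReal R * (ENNReal.ofReal (A ^ d) + ENNReal.ofReal (A ^ d)) := by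
        rw [lintegral_const_mul _ (by fun_prop), lintegral_add_left h1,
          lintegral_enorm_cubeIndC hA, lintegral_enorm_cubeIndC hA]
    _ = _ := by
        rw [← ENNReal.ofReal_add (by positivity) (by positivity), ← ENNReal.ofReal_mul hR]
        congr 1
        ring

end Perturbation

theorem lintegral_enorm_fourier_sq {d : ℕ} (u : SchwartzMap (Ed d) ℂ) :
    ∫⁻ ξ, ‖𝓕 (⇑u) ξ‖ₑ ^ 2 = ENNReal.ofReal ((eLpNorm (⇑u) 2 volume).toReal ^ 2) := by
  have key : ∀ v : SchwartzMap (Ed d) ℂ, ∫⁻ ξ, ‖v ξ‖ₑ ^ 2 = ENNReal.ofReal (∫ ξ, ‖v ξ‖ ^ 2) := by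
    intro v
    have hv := (memLp_two_iff_integrable_sq_norm (v.memLp 2 volume).1).1 (v.memLp 2 volume)
    rw [ofReal_integral_eq_lintegral_ofReal hv (ae_of_all _ fun ξ => by positivity)]
    simp [ENNReal.ofReal_pow]
  rw [← SchwartzMap.fourier_coe, key, SchwartzMap.integral_norm_sq_fourier, ← key,
    ENNReal.ofReal_pow ENNReal.toReal_nonneg, ENNReal.ofReal_toReal (u.memLp 2 volume).2.ne,
    eLpNorm_eq_lintegral_rpow_enorm_toReal two_ne_zero ENNReal.ofNat_ne_top]
  rw [← ENNReal.rpow_natCast, ← ENNReal.rpow_mul]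
  norm_num

/-- **Lemma 2.7, estimate (2.22)**: Sobolev bounds on the higher Picard iterates:
`‖Θ_j(u₀ + φ_{R,A,N})(t)‖_{H^s} ≤ Cʲ tʲ (RA^d)^{4j} (R f_s(A) + ‖u₀‖_{L²})` for `j ≥ 1`,
for a constant `C` depending only on `d` and `s`. -/
theorem higher_iterates_Hs_bound (d : ℕ) (hd : 0 < d) (s : ℝ)
    (hs1 : d = 1 → s ≤ -(1/2 : ℝ)) (hs2 : 2 ≤ d → s < 0)
    (μ : ℝ) (hμ : μ = 1 ∨ μ = -1) :
    ∃ C > (0:ℝ), ∀ u₀ : SchwartzMap (Ed d) ℂ,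
      ∀ R A N : ℝ, 0 < R → 0 < A → 0 < N → 2 ≤ A → Real.sqrt d * A ≤ N →
        max 1 (∫ ξ, ‖𝓕 (⇑u₀) ξ‖) ≤ R * A ^ d →
        ∀ j : ℕ, 1 ≤ j → ∀ t : ℝ, 0 ≤ t →
          hSobHat s
              (FTheta d μ (fun ξ => 𝓕 (⇑u₀) ξ + phiHat d hd R A N ξ) j t) ≤
            C ^ j * t ^ j * (R * A ^ d) ^ (4 * j) *
              (R * fS d s A + (eLpNorm (⇑u₀) 2 volume).toReal) := by
  have hs : s < 0 := by
    rcases (Nat.succ_le_of_lt hd).eq_or_lt with h | h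
    · linarith [hs1 h.symm]
    · exact hs2 h
  obtain ⟨C, hC, hweight⟩ := exists_sobolevWeight_bound hd hs
  have hμ' : ‖μ‖ₑ = 1 := by rcases hμ with rfl | rfl <;> simp
  refine ⟨64 * 81 * (16 * C + 2), by positivity, ?_⟩
  intro u₀ R A N hR hA hN hA2 hAN hM j hj t ht
  obtain ⟨hball, hAB⟩ := hweight A hA2
  have hf := fS_nonneg d s hA2
  set f := fS d s A with hf_def
  set L := (eLpNorm (⇑u₀) 2 volume).toReal with hL
  set M := R * A ^ d with hM_def
  have hL0 : 0 ≤ L := ENNReal.toReal_nonneg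
  have hM0 : 0 ≤ M := by positivity
  have mp := measurable_phiHat hd R A N
  have mu : Measurable (𝓕 (⇑u₀)) := by
    rw [← SchwartzMap.fourier_coe]
    exact (𝓕 u₀).continuous.measurable
  have hu_int : ∫⁻ ξ, ‖𝓕 (⇑u₀) ξ‖ₑ ≤ ENNReal.ofReal M := by
    rw [← ofReal_integral_norm_eq_lintegral_enorm (𝓕 u₀).integrable]
    exact ENNReal.ofReal_le_ofReal ((le_max_right _ _).trans hM)
  have hp_int : ∫⁻ ξ, ‖phiHat d hd R A N ξ‖ₑ ≤ ENNReal.ofReal (2 * M) :=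
    lintegral_enorm_phiHat_le hd hR.le hA.le N
  have hpu : ∀ ξ, ‖𝓕 (⇑u₀) ξ + phiHat d hd R A N ξ‖ₑ ≤
      ‖phiHat d hd R A N ξ‖ₑ + ‖𝓕 (⇑u₀) ξ‖ₑ := fun ξ => by
    rw [add_comm (‖phiHat d hd R A N ξ‖ₑ)]
    exact enorm_add_le _ _
  have h_int : ∫⁻ ξ, ‖𝓕 (⇑u₀) ξ + phiHat d hd R A N ξ‖ₑ ≤ ENNReal.ofReal (3 * M) := by
    calc _ ≤ _ := lintegral_mono hpu
      _ ≤ ENNReal.ofReal (2 * M) + ENNReal.ofReal M := by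
        rw [lintegral_add_left mp.enorm]
        exact add_le_add hp_int hu_int
      _ = _ := by
        rw [← ENNReal.ofReal_add (by positivity) hM0]
        congr 1
        ring
  have htree : ∀ T : Tree5, T.internal = j → _ := fun T hT => hT ▸
    T.lintegral_sobolevWeight_mul_majorant_sq_le hs.le (mu.add mp).enorm mp.enorm mu.enorm hpu hA hR.le
      (by positivity : (0 : ℝ) ≤ 3 * M) (by positivity) h_int
      (enorm_phiHat_le hd hR.le A N) hp_int (lintegral_enorm_fourier_sq u₀).le hball hAB
  refine hSobHat_le_of_lintegral_le (by positivity)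
    ((lintegral_sobolevWeight_mul_enorm_FTheta_sq_le hμ' (mu.add mp) hj ht htree).trans
      (ENNReal.ofReal_le_ofReal ?_))
  rw [← hL]
  have hRf : 0 ≤ R * f := by positivity
  have hD : 2 * (8 * (C * f ^ 2) * R ^ 2 + L ^ 2) ≤ ((16 * C + 2) * (R * f + L)) ^ 2 := by
    have h1 : (16 * C + 2) * ((R * f) ^ 2 + L ^ 2) ≤
        (16 * C + 2) ^ 2 * ((R * f) ^ 2 + L ^ 2) := by
      gcongr
      nlinarith
    have h2 : (16 * C + 2) ^ 2 * ((R * f) ^ 2 + L ^ 2) ≤ (16 * C + 2) ^ 2 * (R * f + L) ^ 2 := by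
      gcongr
      nlinarith [mul_nonneg hRf hL0]
    have h3 : 0 ≤ C * L ^ 2 := by positivity
    nlinarith [sq_nonneg (R * f)]
  have hDj : 16 * C + 2 ≤ (16 * C + 2) ^ j := le_self_pow₀ (by linarith) (by lia)
  calc (64 ^ j * t ^ j) ^ 2 * (2 * ((3 * M) ^ (4 * j)) ^ 2 * (8 * (C * f ^ 2) * R ^ 2 + L ^ 2))
      = (64 ^ j * t ^ j * (3 * M) ^ (4 * j)) ^ 2 * (2 * (8 * (C * f ^ 2) * R ^ 2 + L ^ 2)) := by
        ring
    _ ≤ (64 ^ j * t ^ j * (3 * M) ^ (4 * j)) ^ 2 * ((16 * C + 2) * (R * f + L)) ^ 2 := by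
        gcongr
    _ ≤ (64 ^ j * t ^ j * (3 * M) ^ (4 * j)) ^ 2 * ((16 * C + 2) ^ j * (R * f + L)) ^ 2 := by
        gcongr
    _ = _ := by
        have h81 : (3 * M) ^ (4 * j) = 81 ^ j * M ^ (4 * j) := by
          rw [mul_pow, pow_mul 3]
          norm_num
        rw [h81, mul_pow (64 * 81 : ℝ), mul_pow (64 : ℝ) 81]
        ring
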